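/- arXiv:1503.03147 — 4 statements merged into one kernel-verified Lean document; each statement's English description precedes it below -/
import Mathlib

section
/- Suppose X is ≤^d-d-complete, X is d^∨-complete where d^∨(x,y) = max(d(x,y), d(y,x)), and d_F(r) ≤ r for all r ∈ [0,∞], where d_F(r) = sup over x ∈ X and finite F ⊆ {y : d(y,x) < r} of inf { d(y,x) : y ∈ X such that d(z,y) = 0 for all z ∈ F }. Then X is d-complete. -/
open scoped ENNReal

universe u v

/-- liminf of a `[0,∞]`-valued net indexed by a set with relation `r`. -/
noncomputable def netLiminf {ι : Type v} (r : ι → ι → Prop) (f : ι → ℝ≥0∞) : ℝ≥0∞ :=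
  ⨆ γ : ι, ⨅ l : ι, ⨅ _ : r γ l, f l

/-- limsup of a `[0,∞]`-valued net indexed by a set with relation `r`. -/
noncomputable def netLimsup {ι : Type v} (r : ι → ι → Prop) (f : ι → ℝ≥0∞) : ℝ≥0∞ :=
  ⨅ γ : ι, ⨆ l : ι, ⨆ _ : r γ l, f l

/-- `lim f = L` : both liminf and limsup equal `L`. -/
def NetLimEq {ι : Type v} (r : ι → ι → Prop) (f : ι → ℝ≥0∞) (L : ℝ≥0∞) : Prop :=
  netLiminf r f = L ∧ netLimsup r f = L

/-- `d` satisfies the triangle inequality. -/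
def IsDistance {X : Type u} (d : X → X → ℝ≥0∞) : Prop :=
  ∀ x y z, d x z ≤ d x y + d y z

/-- the index relation is transitive and directed. -/
def DirectedIndex {ι : Type v} (r : ι → ι → Prop) : Prop :=
  (∀ a b c : ι, r a b → r b c → r a c) ∧ (∀ a b : ι, ∃ c, r a c ∧ r b c)

/-- `d`-Cauchy net. -/
def IsCauchyNet {X : Type u} {ι : Type v} (d : X → X → ℝ≥0∞) (r : ι → ι → Prop)
    (x : ι → X) : Prop :=
  ∀ ε : ℝ≥0∞, 0 < ε → ∃ α, ∀ γ δ, r α γ → r γ δ → d (x γ) (x δ) < ε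

/-- `d`-pre-Cauchy net. -/
def IsPreCauchyNet {X : Type u} {ι : Type v} (d : X → X → ℝ≥0∞) (r : ι → ι → Prop)
    (x : ι → X) : Prop :=
  ∀ ε : ℝ≥0∞, 0 < ε → ∃ α, ∀ γ, r α γ → ∃ β, ∀ δ, r β δ → d (x γ) (x δ) < ε

/-- `d`-reflexive net. -/
def IsReflexiveNet {X : Type u} {ι : Type v} (d : X → X → ℝ≥0∞) (r : ι → ι → Prop)
    (x : ι → X) : Prop :=
  ∀ ε : ℝ≥0∞, 0 < ε → ∃ α, ∀ γ, r α γ → ∀ β, ∃ δ, r β δ ∧ d (x γ) (x δ) < ε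

/-- `x` is a `d`-supremum of `Y`. -/
def IsDSup {X : Type u} (d : X → X → ℝ≥0∞) (Y : Set X) (x : X) : Prop :=
  (∀ y ∈ Y, d y x = 0) ∧ ∀ z, d x z = ⨆ y ∈ Y, d y z

/-- `x` is a `≤ᵈ`-supremum of `Y`. -/
def IsLeDSup {X : Type u} (d : X → X → ℝ≥0∞) (Y : Set X) (x : X) : Prop :=
  (∀ y ∈ Y, d y x = 0) ∧ ∀ z, (∀ y ∈ Y, d y z = 0) → d x z = 0

/-- `Y` is `d`-directed. -/
def DDirected {X : Type u} (d : X → X → ℝ≥0∞) (Y : Set X) : Prop :=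
  ∀ F : Finset X, ↑F ⊆ Y → ∀ ε : ℝ≥0∞, 0 < ε → ∃ y ∈ Y, ∀ z ∈ F, d z y < ε

/-- `Y` is `≤ᵈ`-directed (directed sets are nonempty). -/
def LeDDirected {X : Type u} (d : X → X → ℝ≥0∞) (Y : Set X) : Prop :=
  Y.Nonempty ∧ ∀ y₁ ∈ Y, ∀ y₂ ∈ Y, ∃ y ∈ Y, d y₁ y = 0 ∧ d y₂ y = 0

/-- `X` is `f`-complete: every `f`-Cauchy net has an `X°°`-limit w.r.t. `f`. -/
def IsYonedaComplete {X : Type u} (f : X → X → ℝ≥0∞) : Prop :=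
  ∀ (ι : Type u) (r : ι → ι → Prop) (x : ι → X), Nonempty ι → DirectedIndex r →
    IsCauchyNet f r x →
    ∃ z : X, (∀ c, f z c ≤ netLiminf r fun l => f (x l) c) ∧
             (∀ c, f c z ≤ netLiminf r fun l => f c (x l))

/-- `d^•(s) = sup_x inf { d(x,y) : y ≤ᵈ x^•_s }`. -/
noncomputable def dBulletUpper {X : Type u} (d : X → X → ℝ≥0∞) (s : ℝ≥0∞) : ℝ≥0∞ :=
  ⨆ x : X, ⨅ y : X, ⨅ _ : ∀ z, d x z < s → d y z = 0, d x y

/-- `d_•(s) = sup_x inf { d(y,x) : x^s_• ≤ᵈ y }`. -/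
noncomputable def dBulletLower {X : Type u} (d : X → X → ℝ≥0∞) (s : ℝ≥0∞) : ℝ≥0∞ :=
  ⨆ x : X, ⨅ y : X, ⨅ _ : ∀ z, d z x < s → d z y = 0, d y x

/-- `d_F(s)`. -/
noncomputable def dFin {X : Type u} (d : X → X → ℝ≥0∞) (s : ℝ≥0∞) : ℝ≥0∞ :=
  ⨆ x : X, ⨆ F : Finset X, ⨆ _ : ∀ z ∈ F, d z x < s,
    ⨅ y : X, ⨅ _ : ∀ z ∈ F, d z y = 0, d y x

/-- `d_Φ(s)`. -/
noncomputable def dPhi {X : Type u} (d : X → X → ℝ≥0∞) (s : ℝ≥0∞) : ℝ≥0∞ :=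
  ⨆ x : X, ⨆ F : Finset X, ⨆ _ : ∀ z ∈ F, d z x < s, ⨆ ε : ℝ≥0∞, ⨆ _ : 0 < ε,
    ⨅ y : X, ⨅ _ : ∀ z ∈ F, d z y < ε, d y x

/-- `e∘Φᵈ(x,y) = sup_{ε>0} inf { e(x,z) : d(z,y) < ε }`. -/
noncomputable def ePhiD {X : Type u} (e d : X → X → ℝ≥0∞) (x y : X) : ℝ≥0∞ :=
  ⨆ ε : ℝ≥0∞, ⨆ _ : 0 < ε, ⨅ z : X, ⨅ _ : d z y < ε, e x z

/-- `f ⪅ g` : uniform subequivalence. -/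
def SubEquiv {X : Type u} (f g : X → X → ℝ≥0∞) : Prop :=
  ∀ ε : ℝ≥0∞, 0 < ε → ∃ δ : ℝ≥0∞, 0 < δ ∧ ∀ x y, g x y ≤ δ → f x y ≤ ε

theorem le_netLiminf {ι : Type v} {r : ι → ι → Prop} {f : ι → ℝ≥0∞} {a : ℝ≥0∞} (γ : ι)
    (h : ∀ l, r γ l → a ≤ f l) : a ≤ netLiminf r f :=
  le_iSup_of_le γ (le_iInf₂ h)

theorem netLiminf_le_of_eventually_le {ι : Type v} {r : ι → ι → Prop} (hr : DirectedIndex r)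
    {f : ι → ℝ≥0∞} {a : ℝ≥0∞} (γ : ι) (h : ∀ l, r γ l → f l ≤ a) : netLiminf r f ≤ a := by
  refine iSup_le fun β => ?_
  obtain ⟨l, hγ, hβ⟩ := hr.2 γ β
  exact iInf₂_le_of_le l hβ (h l hγ)

/-- If `d_F(s) ≤ s < t`, finite subsets of the open lower `s`-ball at `x` have upper bounds in
the open lower `t`-ball. -/
theorem exists_upper_bound_of_dFin_le {X : Type u} {d : X → X → ℝ≥0∞} {s t : ℝ≥0∞}
    (hF : dFin d s ≤ s) (hst : s < t) (x : X) (F : Finset X) (h : ∀ z ∈ F, d z x < s) :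
    ∃ y, (∀ z ∈ F, d z y = 0) ∧ d y x < t := by
  have hle : (⨅ y : X, ⨅ _ : ∀ z ∈ F, d z y = 0, d y x) ≤ dFin d s :=
    le_iSup_of_le x (le_iSup_of_le F (le_iSup_of_le h le_rfl))
  have hlt := (hle.trans hF).trans_lt hst
  simpa only [iInf_lt_iff, exists_prop] using hlt

/-- The points that eventually lie within some `s < ε` below the net `x`. -/
def netLowerBall {X : Type u} {ι : Type v} (d : X → X → ℝ≥0∞) (r : ι → ι → Prop) (x : ι → X)
    (ε : ℝ≥0∞) : Set X :=
  {y | ∃ s < ε, ∃ γ, ∀ l, r γ l → d y (x l) ≤ s}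

section CauchyNet

variable {X : Type u} {ι : Type v} {d : X → X → ℝ≥0∞} {r : ι → ι → Prop} {x : ι → X}
  {ε : ℝ≥0∞}

theorem IsCauchyNet.eventually_mem_netLowerBall (hx : IsCauchyNet d r x)
    (hε : 0 < ε) : ∃ γ, ∀ l, r γ l → x l ∈ netLowerBall d r x ε := by
  obtain ⟨s, hs0, hsε⟩ := exists_between hε
  obtain ⟨α, hα⟩ := hx s hs0
  exact ⟨α, fun l hl => ⟨s, hsε, l, fun δ hδ => (hα l δ hl hδ).le⟩⟩

theorem IsCauchyNet.leDDirected_netLowerBall [Nonempty ι] (hd : IsDistance d)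
    (hF : ∀ s, dFin d s ≤ s) (hr : DirectedIndex r) (hx : IsCauchyNet d r x) (hε : 0 < ε) :
    LeDDirected d (netLowerBall d r x ε) := by
  classical
  constructor
  · obtain ⟨γ, hγ⟩ := hx.eventually_mem_netLowerBall hε
    obtain ⟨l, hl, -⟩ := hr.2 γ γ
    exact ⟨x l, hγ l hl⟩
  · rintro y₁ ⟨s₁, hs₁, γ₁, h₁⟩ y₂ ⟨s₂, hs₂, γ₂, h₂⟩
    obtain ⟨t, hst, htε⟩ := exists_between (max_lt hs₁ hs₂)
    obtain ⟨t', htt', ht'ε⟩ := exists_between htε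
    obtain ⟨u, htu, huε⟩ := exists_between ht'ε
    obtain ⟨α, hα⟩ := hx (u - t') (tsub_pos_of_lt htu)
    obtain ⟨β, hβ₁, hβ₂⟩ := hr.2 γ₁ γ₂
    obtain ⟨l, hlβ, hlα⟩ := hr.2 β α
    obtain ⟨y, hy, hyl⟩ := exists_upper_bound_of_dFin_le (hF t) htt' (x l) {y₁, y₂} (by
      simp only [Finset.mem_insert, Finset.mem_singleton, forall_eq_or_imp, forall_eq]
      exact ⟨(h₁ l (hr.1 _ _ _ hβ₁ hlβ)).trans_lt ((le_max_left _ _).trans_lt hst),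
        (h₂ l (hr.1 _ _ _ hβ₂ hlβ)).trans_lt ((le_max_right _ _).trans_lt hst)⟩)
    refine ⟨y, ⟨u, huε, l, fun δ hδ => ?_⟩, hy y₁ (by simp), hy y₂ (by simp)⟩
    calc d y (x δ) ≤ d y (x l) + d (x l) (x δ) := hd _ _ _
      _ ≤ t' + (u - t') := add_le_add hyl.le (hα l δ hlα hδ).le
      _ = u := add_tsub_cancel_of_le htu.le

theorem le_add_netLiminf_of_mem_netLowerBall (hd : IsDistance d) {y : X}
    (hy : y ∈ netLowerBall d r x ε) (c : X) :
    d y c ≤ ε + netLiminf r fun l => d (x l) c := by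
  obtain ⟨s, hs, γ, h⟩ := hy
  rw [← tsub_le_iff_left]
  refine le_netLiminf γ fun l hl => tsub_le_iff_left.2 ?_
  exact (hd _ (x l) _).trans (by gcongr; exact (h l hl).trans hs.le)

theorem IsCauchyNet.exists_approx_limit [Nonempty ι] (hd : IsDistance d)
    (hcomp : ∀ Y : Set X, LeDDirected d Y → ∃ x : X, IsDSup d Y x)
    (hF : ∀ s, dFin d s ≤ s) (hr : DirectedIndex r) (hx : IsCauchyNet d r x) (hε : 0 < ε) :
    ∃ z, (∃ γ, ∀ l, r γ l → d (x l) z = 0) ∧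
      ∀ c, d z c ≤ ε + netLiminf r fun l => d (x l) c := by
  obtain ⟨z, hz, hz'⟩ := hcomp _ (hx.leDDirected_netLowerBall hd hF hr hε)
  obtain ⟨γ, hγ⟩ := hx.eventually_mem_netLowerBall hε
  refine ⟨z, ⟨γ, fun l hl => hz _ (hγ l hl)⟩, fun c => ?_⟩
  rw [hz']
  exact iSup₂_le fun y hy => le_add_netLiminf_of_mem_netLowerBall hd hy c

end CauchyNet

/-- Completeness for sequences, with an explicit modulus of convergence. -/
theorem IsYonedaComplete.exists_forall_le {X : Type u} {f : X → X → ℝ≥0∞}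
    (hf : IsYonedaComplete f) {z : ℕ → X} {a : ℕ → ℝ≥0∞} (ha0 : ∀ ε > 0, ∃ n, a n < ε)
    (hz : ∀ m n, m ≤ n → f (z m) (z n) ≤ a m ∧ f (z n) (z m) ≤ a m) (ha : Antitone a) :
    ∃ w, ∀ m, f (z m) w ≤ a m ∧ f w (z m) ≤ a m := by
  have hdir : DirectedIndex fun m n : ULift.{u} ℕ => m.down ≤ n.down :=
    ⟨fun _ _ _ => le_trans, fun m n => ⟨⟨max m.down n.down⟩, le_max_left _ _, le_max_right _ _⟩⟩
  obtain ⟨w, hw, hw'⟩ := hf (ULift.{u} ℕ) (fun m n => m.down ≤ n.down) (fun n => z n.down)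
    ⟨⟨0⟩⟩ hdir (by
      intro ε hε
      obtain ⟨n, hn⟩ := ha0 ε hε
      exact ⟨⟨n⟩, fun γ δ hγ hδ => (hz _ _ hδ).1.trans_lt ((ha hγ).trans_lt hn)⟩)
  exact ⟨w, fun m => ⟨(hw' _).trans (netLiminf_le_of_eventually_le hdir ⟨m⟩ fun l hl =>
    (hz m l.down hl).1), (hw _).trans (netLiminf_le_of_eventually_le hdir ⟨m⟩ fun l hl =>
    (hz m l.down hl).2)⟩⟩

/-- If `X` is `≤ᵈ`-d-complete, `d^∨`-complete and `d_F ≤ I` then `X` is d-complete. -/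
theorem yoneda_complete_of_leDD_and_sym_complete {X : Type u}
    (d : X → X → ℝ≥0∞) (hd : IsDistance d)
    (hcomp : ∀ Y : Set X, LeDDirected d Y → ∃ x : X, IsDSup d Y x)
    (hsym : IsYonedaComplete (fun x y : X => max (d x y) (d y x)))
    (hF : ∀ s : ℝ≥0∞, dFin d s ≤ s) :
    IsYonedaComplete d := by
  intro ι r x hι hr hx
  have hpos : ∀ n : ℕ, (0 : ℝ≥0∞) < (n : ℝ≥0∞)⁻¹ := fun n =>
    ENNReal.inv_pos.2 (ENNReal.natCast_ne_top n)
  have hanti : Antitone fun n : ℕ => (n : ℝ≥0∞)⁻¹ := fun m n h =>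
    ENNReal.inv_le_inv.2 (by exact_mod_cast h)
  have hsmall : ∀ ε > 0, ∃ n : ℕ, (n : ℝ≥0∞)⁻¹ < ε := fun ε hε =>
    ENNReal.exists_inv_nat_lt hε.ne'
  choose z hz0 hz using fun n : ℕ => hx.exists_approx_limit hd hcomp hF hr (hpos n)
  have hzz : ∀ m n, d (z m) (z n) ≤ (m : ℝ≥0∞)⁻¹ := by
    intro m n
    obtain ⟨γ, hγ⟩ := hz0 n
    refine (hz m (z n)).trans ?_
    have h0 := netLiminf_le_of_eventually_le hr (a := 0) γ fun l hl => (hγ l hl).le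
    rw [nonpos_iff_eq_zero.1 h0, add_zero]
  obtain ⟨w, hw⟩ := hsym.exists_forall_le hsmall (z := z) (fun m n h =>
    ⟨max_le (hzz m n) ((hzz n m).trans (hanti h)),
      max_le ((hzz n m).trans (hanti h)) (hzz m n)⟩) hanti
  refine ⟨w, fun c => ?_, fun c => ?_⟩
  · refine ENNReal.le_of_forall_pos_le_add fun ε hε _ => ?_
    obtain ⟨n, hn⟩ := hsmall (ε / 2) (ENNReal.half_pos (by exact_mod_cast hε.ne'))
    calc d w c ≤ d w (z n) + d (z n) c := hd _ _ _
      _ ≤ ε / 2 + (ε / 2 + netLiminf r fun l => d (x l) c) := by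
        gcongr
        · exact ((le_max_right _ _).trans (hw n).1).trans hn.le
        · exact (hz n c).trans (by gcongr)
      _ = (netLiminf r fun l => d (x l) c) + ε := by
        rw [← add_assoc, ENNReal.add_halves, add_comm]
  · refine ENNReal.le_of_forall_pos_le_add fun ε hε _ => ?_
    obtain ⟨n, hn⟩ := hsmall ε (by exact_mod_cast hε)
    obtain ⟨γ, hγ⟩ := hz0 n
    rw [← tsub_le_iff_right]
    refine le_netLiminf γ fun l hl => tsub_le_iff_right.2 ?_
    calc d c w ≤ d c (x l) + d (x l) w := hd _ _ _
      _ ≤ d c (x l) + (d (x l) (z n) + d (z n) w) := by gcongr; exact hd _ _ _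
      _ ≤ d c (x l) + ε := by
        rw [hγ l hl, zero_add]
        gcongr
        exact ((le_max_left _ _).trans (hw n).1).trans hn.le
end

section
/- Let e be a symmetric distance on X (e(x,y) = e(y,x) for all x,y). Suppose X is d-d-complete, X is e-complete, e∘Φ^d ⪅ d, and d ⪅ e. Then X is d-complete. -/
open scoped ENNReal

universe u v

/-- If the distances between consecutive points decay geometrically, then so do the distances
to all later points. -/
theorem IsDistance.le_of_geometric {X : Type u} {e : X → X → ℝ≥0∞} (he : IsDistance e)
    {a : ℝ≥0∞} {w : ℕ → X} (hw : ∀ k, e (w k) (w (k + 1)) ≤ a * 2⁻¹ ^ (k + 1)) {k m : ℕ}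
    (hkm : k < m) : e (w k) (w m) ≤ a * 2⁻¹ ^ k := by
  have halves (k : ℕ) : a * 2⁻¹ ^ (k + 1) + a * 2⁻¹ ^ (k + 1) = a * 2⁻¹ ^ k := by
    rw [← mul_add, pow_succ, ← mul_add, ENNReal.inv_two_add_inv_two, mul_one]
  obtain ⟨n, rfl⟩ := Nat.exists_eq_add_of_lt hkm
  clear hkm
  induction n generalizing k with
  | zero => exact (hw k).trans ((halves k).symm ▸ le_self_add)
  | succ n ih =>
    calc e (w k) (w (k + (n + 1) + 1))
        ≤ e (w k) (w (k + 1)) + e (w (k + 1)) (w (k + 1 + n + 1)) := by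
          rw [show k + (n + 1) + 1 = k + 1 + n + 1 by omega]
          exact he _ _ _
      _ ≤ a * 2⁻¹ ^ (k + 1) + a * 2⁻¹ ^ (k + 1) := add_le_add (hw k) ih
      _ = a * 2⁻¹ ^ k := halves k

theorem ENNReal.exists_mul_inv_two_pow_lt {a ε : ℝ≥0∞} (ha : a ≠ ∞) (hε : 0 < ε) :
    ∃ k : ℕ, a * 2⁻¹ ^ k < ε := by
  have h : Filter.Tendsto (fun k : ℕ => a * 2⁻¹ ^ k) Filter.atTop (nhds (a * 0)) :=
    ENNReal.Tendsto.const_mul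
      (ENNReal.tendsto_pow_atTop_nhds_zero_of_lt_one (by simp)) (Or.inr ha)
  rw [mul_zero] at h
  exact (h.eventually_lt_const hε).exists

/-- In a complete symmetric distance, a geometrically Cauchy sequence converges geometrically. -/
theorem IsYonedaComplete.exists_limit_of_geometric {X : Type u} {e : X → X → ℝ≥0∞}
    (hcomp : IsYonedaComplete e) (he : IsDistance e) (hsym : ∀ x y, e x y = e y x)
    {a : ℝ≥0∞} (ha : a ≠ ∞) {w : ℕ → X} (hw : ∀ k, e (w k) (w (k + 1)) ≤ a * 2⁻¹ ^ (k + 1)) :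
    ∃ z, ∀ k, e z (w k) ≤ a * 2⁻¹ ^ k := by
  obtain ⟨z, hz, -⟩ := hcomp (ULift.{u} ℕ) (fun m n => m.down < n.down) (fun n => w n.down)
    inferInstance
    ⟨fun _ _ _ => lt_trans, fun m n => ⟨⟨max m.down n.down + 1⟩,
      Nat.lt_succ_of_le (le_max_left _ _), Nat.lt_succ_of_le (le_max_right _ _)⟩⟩
    (fun ε hε => by
      obtain ⟨k, hk⟩ := ENNReal.exists_mul_inv_two_pow_lt ha hε
      refine ⟨⟨k⟩, fun m n hkm hmn => (he.le_of_geometric hw hmn).trans_lt (lt_of_le_of_lt ?_ hk)⟩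
      gcongr a * ?_
      exact pow_le_pow_right_of_le_one' (ENNReal.inv_le_one.2 one_le_two) (le_of_lt hkm))
  refine ⟨z, fun k => (hz (w k)).trans (iSup_le fun m => ?_)⟩
  refine (iInf₂_le (ULift.up (max m.down k + 1))
    (Nat.lt_succ_of_le (le_max_left _ _))).trans ?_
  exact (hsym _ _).trans_le <|
    he.le_of_geometric hw (Nat.lt_succ_of_le (le_max_right _ _))

theorem SubEquiv.exists_interpolant {X : Type u} {d e : X → X → ℝ≥0∞}
    (h : SubEquiv (ePhiD e d) d) {ε : ℝ≥0∞} (hε : 0 < ε) :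
    ∃ δ : ℝ≥0∞, 0 < δ ∧ ∀ x y, d x y ≤ δ → ∀ η : ℝ≥0∞, 0 < η → ∃ z, d z y < η ∧ e x z < ε := by
  obtain ⟨ε', hε'₀, hε'⟩ := exists_between hε
  obtain ⟨δ, hδ, H⟩ := h ε' hε'₀
  refine ⟨δ, hδ, fun x y hxy η hη => ?_⟩
  have hlt : ⨅ z : X, ⨅ _ : d z y < η, e x z < ε :=
    ((le_iSup₂ (f := fun (η : ℝ≥0∞) (_ : 0 < η) => ⨅ z : X, ⨅ _ : d z y < η, e x z) η hη).trans
      (H x y hxy)).trans_lt hε'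
  simpa only [iInf_lt_iff, exists_prop] using hlt

/-- `d y (x l)` tends to `0` along the net `x`. -/
def IsNetLower {X : Type u} {ι : Type v} (d : X → X → ℝ≥0∞) (r : ι → ι → Prop) (x : ι → X)
    (y : X) : Prop :=
  ∀ η : ℝ≥0∞, 0 < η → ∃ β, ∀ l, r β l → d y (x l) < η

/-- The tail of a `d`-Cauchy net can be `e`-approximated by points that are asymptotically
`d`-below the net. -/
theorem IsCauchyNet.exists_isNetLower {X : Type u} {ι : Type v} {d e : X → X → ℝ≥0∞}
    (hd : IsDistance d) (he : IsDistance e) (hsym : ∀ x y, e x y = e y x)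
    (hcomp : IsYonedaComplete e) (h1 : SubEquiv (ePhiD e d) d) (h2 : SubEquiv d e)
    {r : ι → ι → Prop} (hr : DirectedIndex r) {x : ι → X} (hx : IsCauchyNet d r x)
    {ε : ℝ≥0∞} (hε : 0 < ε) :
    ∃ α, ∀ γ, r α γ → ∃ y, IsNetLower d r x y ∧ e (x γ) y ≤ ε := by
  obtain ⟨a, ha₀, ha⟩ : ∃ a : ℝ≥0∞, 0 < a ∧ a ≤ ε ∧ a ≠ ∞ :=
    ⟨min ε 1, lt_min hε one_pos, min_le_left _ _, ((min_le_right _ _).trans_lt (by simp)).ne⟩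
  have ht (k : ℕ) : 0 < a * 2⁻¹ ^ k :=
    ENNReal.mul_pos ha₀.ne' (pow_ne_zero _ (by simp))
  choose δ' hδ'₀ hδ' using fun k : ℕ => h1.exists_interpolant (ht (k + 1))
  let δ (k : ℕ) : ℝ≥0∞ := min (δ' k) (a * 2⁻¹ ^ k)
  have hδ₀ (k : ℕ) : 0 < δ k := lt_min (hδ'₀ k) (ht k)
  let S (k : ℕ) := {p : X × ι // ∀ l, r p.2 l → d p.1 (x l) ≤ δ k}
  have step (k : ℕ) (p : S k) : ∃ q : S (k + 1), e p.1.1 q.1.1 ≤ a * 2⁻¹ ^ (k + 1) := by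
    have hhalf : 0 < δ (k + 1) / 2 := ENNReal.half_pos (hδ₀ _).ne'
    obtain ⟨α, hα⟩ := hx _ hhalf
    obtain ⟨γ, hpγ, hαγ⟩ := hr.2 p.1.2 α
    obtain ⟨z, hzγ, hz⟩ := hδ' k p.1.1 (x γ) ((p.2 γ hpγ).trans (min_le_left _ _)) _ hhalf
    refine ⟨⟨(z, γ), fun l hl => ?_⟩, hz.le⟩
    exact (hd _ _ _).trans
      ((add_le_add hzγ.le (hα γ l hαγ hl).le).trans_eq (ENNReal.add_halves _))
  choose next hnext using step
  obtain ⟨α, hα⟩ := hx (δ 0) (hδ₀ 0)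
  refine ⟨α, fun γ hγ => ?_⟩
  let s (k : ℕ) : S k := Nat.rec ⟨(x γ, γ), fun l hl => (hα γ l hγ hl).le⟩ next k
  obtain ⟨y, hy⟩ := hcomp.exists_limit_of_geometric he hsym ha.2 (w := fun k => (s k).1.1)
    fun k => hnext k (s k)
  refine ⟨y, fun η hη => ?_, ?_⟩
  · have hη₂ : 0 < η / 2 := ENNReal.half_pos hη.ne'
    obtain ⟨η', hη'₀, hη'⟩ := exists_between hη₂
    obtain ⟨θ, hθ, H⟩ := h2 η' hη'₀
    obtain ⟨k, hk⟩ := ENNReal.exists_mul_inv_two_pow_lt ha.2 (lt_min hθ hη₂)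
    refine ⟨(s k).1.2, fun l hl => (hd y (s k).1.1 (x l)).trans_lt ?_⟩
    rw [← ENNReal.add_halves η]
    exact ENNReal.add_lt_add
      ((H _ _ ((hy k).trans (hk.le.trans (min_le_left _ _)))).trans_lt hη')
      ((((s k).2 l hl).trans (min_le_right _ _)).trans_lt (hk.trans_le (min_le_right _ _)))
  · rw [hsym]
    simpa [s] using (hy 0).trans (by simpa using ha.1)

theorem DirectedIndex.exists_forall_mem_finset {ι : Type v} [Nonempty ι] {r : ι → ι → Prop}
    (hr : DirectedIndex r) {X : Type u} (F : Finset X) {β : X → ι} : ∃ γ, ∀ z ∈ F, r (β z) γ := by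
  classical
  induction F using Finset.induction_on with
  | empty => simp
  | insert z F _ ih =>
    obtain ⟨γ, hγ⟩ := ih
    obtain ⟨γ', hz, hγγ'⟩ := hr.2 (β z) γ
    exact ⟨γ', by simpa [hz] using fun y hy => hr.1 _ _ _ (hγ y hy) hγγ'⟩

theorem le_netLiminf_of_forall_pos {ι : Type v} {r : ι → ι → Prop} {f : ι → ℝ≥0∞} {L : ℝ≥0∞}
    (h : ∀ ε : ℝ≥0∞, 0 < ε → ∃ β, ∀ l, r β l → L ≤ f l + ε) : L ≤ netLiminf r f := by
  refine ENNReal.le_of_forall_pos_le_add fun ε hε _ => ?_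
  obtain ⟨β, hβ⟩ := h ε (by exact_mod_cast hε)
  rw [← tsub_le_iff_right]
  exact le_iSup_of_le β (le_iInf₂ fun l hl => tsub_le_iff_right.2 (hβ l hl))

/-- If `e` is a symmetric distance, `X` is d-d-complete, `e`-complete,
`e∘Φᵈ ⪅ d` and `d ⪅ e`, then `X` is d-complete. -/
theorem yoneda_complete_of_dd_and_e_complete {X : Type u}
    (d e : X → X → ℝ≥0∞) (hd : IsDistance d) (he : IsDistance e)
    (hsym : ∀ x y : X, e x y = e y x)
    (hdd : ∀ Y : Set X, DDirected d Y → ∃ x : X, IsDSup d Y x)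
    (hcomp : IsYonedaComplete e)
    (h1 : SubEquiv (ePhiD e d) d) (h2 : SubEquiv d e) :
    IsYonedaComplete d := by
  intro ι r x _ hr hx
  let Y : Set X := {y | IsNetLower d r x y}
  have approx (ε : ℝ≥0∞) (hε : 0 < ε) : ∃ α, ∀ γ, r α γ → ∃ y ∈ Y, d (x γ) y ≤ ε := by
    obtain ⟨θ, hθ, H⟩ := h2 ε hε
    obtain ⟨α, hα⟩ := hx.exists_isNetLower hd he hsym hcomp h1 h2 hr hθ
    refine ⟨α, fun γ hγ => ?_⟩
    obtain ⟨y, hy, hxy⟩ := hα γ hγ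
    exact ⟨y, hy, H _ _ hxy⟩
  have hY : DDirected d Y := by
    intro F hF ε hε
    have hε₂ : 0 < ε / 2 := ENNReal.half_pos hε.ne'
    obtain ⟨ε', hε'₀, hε'⟩ := exists_between hε₂
    obtain ⟨α, hα⟩ := approx ε' hε'₀
    have hβ (z : X) : ∃ β, z ∈ F → ∀ l, r β l → d z (x l) < ε / 2 := by
      by_cases hz : z ∈ F
      · obtain ⟨β, hβ⟩ := hF hz _ hε₂
        exact ⟨β, fun _ => hβ⟩
      · exact ⟨α, fun h => absurd h hz⟩
    choose β hβ using hβ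
    obtain ⟨γ₀, hγ₀⟩ := hr.exists_forall_mem_finset F (β := β)
    obtain ⟨γ, hγ₀γ, hαγ⟩ := hr.2 γ₀ α
    obtain ⟨y, hy, hxy⟩ := hα γ hαγ
    refine ⟨y, hy, fun z hz => (hd z (x γ) y).trans_lt ?_⟩
    rw [← ENNReal.add_halves ε]
    exact ENNReal.add_lt_add (hβ z hz γ (hr.1 _ _ _ (hγ₀ z hz) hγ₀γ)) (hxy.trans_lt hε')
  obtain ⟨z, hYz, hz⟩ := hdd Y hY
  refine ⟨z, fun c => ?_, fun c => le_netLiminf_of_forall_pos fun ε hε => ?_⟩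
  · rw [hz]
    refine iSup₂_le fun y hy => le_netLiminf_of_forall_pos fun ε hε => ?_
    obtain ⟨β, hβ⟩ := hy ε hε
    refine ⟨β, fun l hl => (hd y (x l) c).trans ?_⟩
    rw [add_comm]
    exact add_le_add_right (hβ l hl).le _
  · obtain ⟨α, hα⟩ := approx ε hε
    refine ⟨α, fun l hl => (hd c (x l) z).trans ?_⟩
    obtain ⟨y, hy, hxy⟩ := hα l hl
    gcongr
    simpa [hYz y hy] using (hd (x l) y z).trans (add_le_add_left hxy _)
end

section
/- Let e be a symmetric distance on X (e(x,y) = e(y,x) for all x,y). Suppose X is ≤^d-d-complete, X is e-complete, X is e-separable, e∘Φ^d ⪅ d, and d ⪅ e. Then X is d-complete. -/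
open scoped ENNReal

universe u v

open Filter Topology

section CauchyNets

variable {X : Type u} {d e : X → X → ℝ≥0∞}

lemma netLiminf_le_add {ι : Type v} {r : ι → ι → Prop} {f g : ι → ℝ≥0∞} {a : ℝ≥0∞}
    (h : ∀ l, f l ≤ a + g l) : netLiminf r f ≤ a + netLiminf r g := by
  refine iSup_le fun γ => ?_
  rw [← tsub_le_iff_left]
  refine le_trans ?_ (le_iSup (fun γ => ⨅ l, ⨅ _ : r γ l, g l) γ)
  refine le_iInf₂ fun l hl => ?_
  rw [tsub_le_iff_left]
  exact (iInf₂_le l hl).trans (h l)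

lemma le_add_netLiminf {ι : Type v} {r : ι → ι → Prop} {g : ι → ℝ≥0∞} {a b : ℝ≥0∞} (γ : ι)
    (h : ∀ l, r γ l → b ≤ a + g l) : b ≤ a + netLiminf r g := by
  rw [← tsub_le_iff_left]
  refine le_trans ?_ (le_iSup (fun γ => ⨅ l, ⨅ _ : r γ l, g l) γ)
  refine le_iInf₂ fun l hl => ?_
  rw [tsub_le_iff_left]
  exact h l hl

lemma SubEquiv.tendsto_zero {f g : X → X → ℝ≥0∞} (h : SubEquiv f g) {ι : Type v} {l : Filter ι}
    {a b : ι → X} (hg : Tendsto (fun n => g (a n) (b n)) l (𝓝 0)) :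
    Tendsto (fun n => f (a n) (b n)) l (𝓝 0) := by
  rw [ENNReal.tendsto_nhds_zero] at hg ⊢
  intro ε hε
  obtain ⟨δ, hδ, H⟩ := h ε hε
  filter_upwards [hg δ hδ] with n hn using H _ _ hn

lemma le_of_tendsto_zero_add {a b : ℝ≥0∞} {t : ℕ → ℝ≥0∞} (ht : Tendsto t atTop (𝓝 0))
    (h : ∀ᶠ n in atTop, a ≤ t n + b) : a ≤ b := by
  have h' := ht.add (tendsto_const_nhds (x := b))
  rw [zero_add] at h'
  exact ge_of_tendsto h' h

lemma tendsto_inv_two_pow : Tendsto (fun n : ℕ => ((2 : ℝ≥0∞) ^ n)⁻¹) atTop (𝓝 0) := by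
  simpa only [ENNReal.inv_pow] using
    ENNReal.tendsto_pow_atTop_nhds_zero_of_lt_one (r := 2⁻¹) (by simp)

/-- Every geometrically Cauchy sequence converges in a complete symmetric reflexive distance. -/
lemma exists_tendsto_of_le_geometric (he : IsDistance e) (hsym : ∀ x y, e x y = e y x)
    (hrefl : ∀ x, e x x = 0) (hcomp : IsYonedaComplete e) (u : ℕ → X) {C : ℝ≥0∞} (hC : C ≠ ⊤)
    (hu : ∀ n, e (u n) (u (n + 1)) ≤ C / 2 ^ n) :
    ∃ z, Tendsto (fun n => e (u n) z) atTop (𝓝 0) ∧ e (u 0) z ≤ 2 * C := by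
  let _ : PseudoEMetricSpace X :=
    { edist := e
      edist_self := hrefl
      edist_comm := hsym
      edist_triangle := he }
  have hc : CauchySeq u := cauchySeq_of_edist_le_geometric_two C hC hu
  rw [EMetric.cauchySeq_iff] at hc
  obtain ⟨z, hz, -⟩ := hcomp (ULift.{u} ℕ) (fun a b => a.down ≤ b.down) (fun a => u a.down) ⟨⟨0⟩⟩
    ⟨fun a b c => le_trans, fun a b => ⟨⟨max a.down b.down⟩, le_max_left _ _, le_max_right _ _⟩⟩
    (fun ε hε => by
      obtain ⟨N, hN⟩ := hc ε hε
      exact ⟨⟨N⟩, fun γ δ h h' => hN _ h _ (le_trans h h')⟩)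
  have ht : Tendsto (fun n => e (u n) z) atTop (𝓝 0) := by
    rw [ENNReal.tendsto_nhds_zero]
    intro ε hε
    obtain ⟨N, hN⟩ := hc ε hε
    filter_upwards [eventually_ge_atTop N] with n hn
    rw [hsym]
    refine (hz (u n)).trans (iSup_le fun γ => ?_)
    exact (iInf₂_le (⟨max γ.down N⟩ : ULift.{u} ℕ) (le_max_left _ _)).trans
      (hN _ (le_max_right _ _) _ hn).le
  refine ⟨z, ht, ?_⟩
  exact edist_le_of_edist_le_geometric_two_of_tendsto₀ C hu
    (tendsto_iff_edist_tendsto_0.2 (show Tendsto (fun n => edist (u n) z) atTop (𝓝 0) from ht))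

/-- If `d x y` is small, some point `e`-close to `x` lies exactly `≤ᵈ`-below `y`. -/
lemma exists_close_le (hd : IsDistance d) (he : IsDistance e) (hsym : ∀ x y, e x y = e y x)
    (hrefl : ∀ x, e x x = 0) (hcomp : IsYonedaComplete e)
    (h1 : SubEquiv (ePhiD e d) d) (h2 : SubEquiv d e) {ε : ℝ≥0∞} (hε : 0 < ε) :
    ∃ δ : ℝ≥0∞, 0 < δ ∧ ∀ x y, d x y ≤ δ → ∃ z, e x z ≤ ε ∧ d z y = 0 := by
  obtain ⟨C, hC0, hC⟩ : ∃ C : ℝ≥0∞, 0 < C ∧ 2 * C < ε := by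
    obtain ⟨c, hc0, hc⟩ := exists_between hε
    refine ⟨c / 2, ENNReal.half_pos hc0.ne', ?_⟩
    rwa [ENNReal.mul_div_cancel (by simp) (by simp)]
  have hCt : C ≠ ⊤ := by
    rintro rfl
    simp at hC
  have step : ∀ n : ℕ, ∃ δ : ℝ≥0∞, 0 < δ ∧ ∀ x y, d x y ≤ δ → ∀ η : ℝ≥0∞, 0 < η →
      ∃ z, e x z ≤ C / 2 ^ n ∧ d z y ≤ η := by
    intro n
    obtain ⟨s, hs0, hs⟩ := exists_between
      (ENNReal.div_pos hC0.ne' (by simp) : 0 < C / (2 : ℝ≥0∞) ^ n)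
    obtain ⟨δ, hδ, H⟩ := h1 s hs0
    refine ⟨δ, hδ, fun x y hxy η hη => ?_⟩
    have h3 : (⨅ z : X, ⨅ _ : d z y < η, e x z) < C / 2 ^ n :=
      ((le_iSup₂ (f := fun (η : ℝ≥0∞) (_ : 0 < η) => ⨅ z : X, ⨅ _ : d z y < η, e x z)
        η hη).trans (H x y hxy)).trans_lt hs
    simp only [iInf_lt_iff] at h3
    obtain ⟨z, hz, hz'⟩ := h3
    exact ⟨z, hz'.le, hz.le⟩
  choose δ hδ H using step
  refine ⟨δ 0, hδ 0, fun x y hxy => ?_⟩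
  have next : ∀ (n : ℕ) (p : {w // d w y ≤ δ n}), ∃ q : {w // d w y ≤ δ (n + 1)},
      e p.1 q.1 ≤ C / 2 ^ n ∧ d q.1 y ≤ (2 ^ (n + 1))⁻¹ := by
    intro n p
    obtain ⟨z, hz, hz'⟩ := H n p.1 y p.2 (min (δ (n + 1)) (2 ^ (n + 1))⁻¹)
      (lt_min (hδ _) (by simp))
    exact ⟨⟨z, hz'.trans (min_le_left _ _)⟩, hz, hz'.trans (min_le_right _ _)⟩
  choose N hN using next
  let w : (n : ℕ) → {w // d w y ≤ δ n} := fun n => Nat.rec ⟨x, hxy⟩ N n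
  obtain ⟨z, hz, hz0⟩ := exists_tendsto_of_le_geometric he hsym hrefl hcomp
    (fun n => (w n).1) hCt (fun n => (hN n (w n)).1)
  refine ⟨z, hz0.trans hC.le, ?_⟩
  rw [← nonpos_iff_eq_zero]
  simp_rw [hsym _ z] at hz
  have hlim := ((h2.tendsto_zero hz).comp (tendsto_add_atTop_nat 1)).add
    (tendsto_inv_two_pow.comp (tendsto_add_atTop_nat 1))
  rw [add_zero] at hlim
  refine ge_of_tendsto' hlim fun n => (hd _ (w (n + 1)).1 _).trans ?_
  exact add_le_add le_rfl (hN n (w n)).2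

/-- A sufficiently fast `d`-Cauchy sequence is `e`-asymptotic to a `≤ᵈ`-increasing one. -/
lemma exists_increasing_approx (hd : IsDistance d) (he : IsDistance e)
    (hsym : ∀ x y, e x y = e y x) (hrefl : ∀ x, e x x = 0) (hcomp : IsYonedaComplete e)
    (h1 : SubEquiv (ePhiD e d) d) (h2 : SubEquiv d e) :
    ∃ η : ℕ → ℝ≥0∞, (∀ n, 0 < η n) ∧ ∀ x : ℕ → X, (∀ n, d (x n) (x (n + 1)) ≤ η n) →
      ∃ v : ℕ → X, (∀ n, d (v n) (v (n + 1)) = 0) ∧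
        Tendsto (fun n => e (x n) (v n)) atTop (𝓝 0) := by
  have hP : ∀ ε : ℝ≥0∞, ∃ δ : ℝ≥0∞, 0 < ε → 0 < δ ∧ ∀ x y, d x y ≤ δ →
      ∃ z, e x z ≤ ε ∧ d z y = 0 := by
    intro ε
    rcases eq_or_ne ε 0 with rfl | hε
    · exact ⟨0, fun h => absurd h (lt_irrefl _)⟩
    · obtain ⟨δ, h⟩ := exists_close_le hd he hsym hrefl hcomp h1 h2 (pos_iff_ne_zero.2 hε)
      exact ⟨δ, fun _ => h⟩
  choose g hg using hP
  have hQ : ∀ ε : ℝ≥0∞, ∃ δ : ℝ≥0∞, 0 < ε → 0 < δ ∧ ∀ x y, e x y ≤ δ → d x y ≤ ε := by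
    intro ε
    rcases eq_or_ne ε 0 with rfl | hε
    · exact ⟨0, fun h => absurd h (lt_irrefl _)⟩
    · obtain ⟨δ, h⟩ := h2 ε (pos_iff_ne_zero.2 hε)
      exact ⟨δ, fun _ => h⟩
  choose h hh using hQ
  have hZ : ∀ (ε : ℝ≥0∞) (x y : X), ∃ z, 0 < ε → d x y ≤ g ε → e x z ≤ ε ∧ d z y = 0 := by
    intro ε x y
    by_cases H : 0 < ε ∧ d x y ≤ g ε
    · obtain ⟨z, hz⟩ := (hg ε H.1).2 x y H.2
      exact ⟨z, fun _ _ => hz⟩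
    · exact ⟨x, fun a b => absurd ⟨a, b⟩ H⟩
  choose Z hZ using hZ
  let E : ℕ → ℕ → ℝ≥0∞ := fun k n =>
    Nat.rec ((2 ^ k)⁻¹) (fun _ t => min ((2 ^ k)⁻¹) (h (g t))) n
  have hEpos : ∀ k n, 0 < E k n := by
    intro k n
    induction n with
    | zero => simp [E]
    | succ n ih => exact lt_min (by simp) (hh _ (hg _ ih).1).1
  have hEle : ∀ k n, E k n ≤ (2 ^ k)⁻¹ := by
    intro k n
    cases n with
    | zero => exact le_rfl
    | succ n => exact min_le_left _ _
  have hEsucc : ∀ k n, E k (n + 1) ≤ h (g (E k n)) := fun k n => min_le_right _ _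
  refine ⟨fun n => g (E n n), fun n => (hg _ (hEpos _ _)).1, fun x hx => ?_⟩
  let W : ℕ → ℕ → X := fun j =>
    Nat.rec x (fun j w n => Z (E (n + j) n) (w n) (w (n + 1))) j
  have hinv : ∀ j n, d (W j n) (W j (n + 1)) ≤ g (E (n + j) n) := by
    intro j
    induction j with
    | zero => exact hx
    | succ j ih =>
      intro n
      have ha := hZ _ _ _ (hEpos (n + j) n) (ih n)
      have hb := hZ _ _ _ (hEpos (n + 1 + j) (n + 1)) (ih (n + 1))
      have hk : n + 1 + j = n + (j + 1) := by omega
      calc d (W (j + 1) n) (W (j + 1) (n + 1))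
          ≤ d (W (j + 1) n) (W j (n + 1)) + d (W j (n + 1)) (W (j + 1) (n + 1)) := hd _ _ _
        _ = d (W j (n + 1)) (W (j + 1) (n + 1)) := by
          rw [show d (W (j + 1) n) (W j (n + 1)) = 0 from ha.2, zero_add]
        _ ≤ g (E (n + (j + 1)) n) := by
          refine (hh _ (hg _ (hEpos _ _)).1).2 _ _ (hb.1.trans ?_)
          rw [hk]
          exact hEsucc _ _
  have hW : ∀ j n, e (W j n) (W (j + 1) n) ≤ E (n + j) n ∧ d (W (j + 1) n) (W j (n + 1)) = 0 :=
    fun j n => hZ _ _ _ (hEpos (n + j) n) (hinv j n)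
  have hv : ∀ n, ∃ z, Tendsto (fun j => e (W j n) z) atTop (𝓝 0) ∧
      e (W 0 n) z ≤ 2 * (2 ^ n)⁻¹ := fun n =>
    exists_tendsto_of_le_geometric he hsym hrefl hcomp (fun j => W j n) (by simp) (fun j => by
      refine ((hW j n).1.trans (hEle _ _)).trans (le_of_eq ?_)
      rw [pow_add, ENNReal.mul_inv (by simp) (by simp), div_eq_mul_inv])
  choose v hv hv0 using hv
  refine ⟨v, fun n => ?_, ?_⟩
  · rw [← nonpos_iff_eq_zero]
    have ha := hv n
    simp_rw [hsym _ (v n)] at ha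
    have hlim := ((h2.tendsto_zero ha).comp (tendsto_add_atTop_nat 1)).add
      (h2.tendsto_zero (hv (n + 1)))
    rw [add_zero] at hlim
    refine ge_of_tendsto' hlim fun j => (hd _ (W (j + 1) n) _).trans ?_
    refine add_le_add le_rfl ((hd _ (W j (n + 1)) _).trans ?_)
    rw [(hW j n).2, zero_add]
  · have hlim := ENNReal.Tendsto.const_mul (a := 2) tendsto_inv_two_pow (Or.inr (by simp))
    rw [mul_zero] at hlim
    exact tendsto_of_tendsto_of_tendsto_of_le_of_le tendsto_const_nhds hlim
      (fun _ => zero_le) hv0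

lemma IsCauchyNet.exists_le_netLiminf_add (hd : IsDistance d) {ι : Type v} {r : ι → ι → Prop}
    {x : ι → X} (hx : IsCauchyNet d r x) (y : X) {ε : ℝ≥0∞} (hε : 0 < ε) :
    ∃ β, ∀ l, r β l → d y (x l) ≤ netLiminf r (fun l => d y (x l)) + ε := by
  have hε2 := ENNReal.half_pos hε.ne'
  obtain ⟨α, hα⟩ := hx _ hε2
  by_cases hL : netLiminf r (fun l => d y (x l)) = ⊤
  · exact ⟨α, fun l _ => by simp [hL]⟩
  have h : (⨅ l, ⨅ _ : r α l, d y (x l)) < netLiminf r (fun l => d y (x l)) + ε / 2 :=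
    (le_iSup (fun γ => ⨅ l, ⨅ _ : r γ l, d y (x l)) α).trans_lt
      (ENNReal.lt_add_right hL hε2.ne')
  simp only [iInf_lt_iff] at h
  obtain ⟨β, hβ, h⟩ := h
  refine ⟨β, fun l hl => (hd _ (x β) _).trans ?_⟩
  rw [← ENNReal.add_halves ε, ← add_assoc]
  exact add_le_add h.le (hα β l hβ hl).le

lemma DirectedIndex.exists_chain {ι : Type v} {r : ι → ι → Prop} (hr : DirectedIndex r)
    (κ : ℕ → ι) :
    ∃ l : ℕ → ι, (∀ n, r (l n) (l (n + 1))) ∧ ∀ m n, m ≤ n → r (κ m) (l n) := by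
  choose s hs1 hs2 using hr.2
  let l : ℕ → ι := fun n => Nat.rec (s (κ 0) (κ 0)) (fun n a => s a (κ (n + 1))) n
  have hl : ∀ n, r (l n) (l (n + 1)) := fun n => hs1 _ _
  refine ⟨l, hl, fun m n hmn => ?_⟩
  induction n, hmn using Nat.le_induction with
  | base =>
    cases m with
    | zero => exact hs1 _ _
    | succ m => exact hs2 _ _
  | succ n _ ih => exact hr.1 _ _ _ ih (hl n)

end CauchyNets

/-- If `e` is a symmetric distance, `X` is `≤ᵈ`-d-complete, `e`-complete,
`e`-separable, `e∘Φᵈ ⪅ d` and `d ⪅ e`, then `X` is d-complete. -/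
theorem yoneda_complete_of_leDD_and_e_complete_sep {X : Type u}
    (d e : X → X → ℝ≥0∞) (hd : IsDistance d) (he : IsDistance e)
    (hsym : ∀ x y : X, e x y = e y x)
    (hdd : ∀ Y : Set X, LeDDirected d Y → ∃ x : X, IsDSup d Y x)
    (hcomp : IsYonedaComplete e)
    (hsep : ∃ Y₀ : Set X, Y₀.Countable ∧ ∀ x : X, (⨅ y ∈ Y₀, e x y) = 0)
    (h1 : SubEquiv (ePhiD e d) d) (h2 : SubEquiv d e) :
    IsYonedaComplete d := by
  intro ι r x hι hr hx
  obtain ⟨Y₀, hY₀, hY⟩ := hsep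
  have hnear : ∀ c : X, ∀ ε : ℝ≥0∞, 0 < ε → ∃ y ∈ Y₀, e c y < ε := by
    intro c ε hε
    rw [← hY c] at hε
    simpa only [iInf_lt_iff, exists_prop] using hε
  have hrefl : ∀ c, e c c = 0 := by
    intro c
    rw [← nonpos_iff_eq_zero]
    refine le_of_forall_pos_le_add fun ε hε => ?_
    obtain ⟨y, -, hy⟩ := hnear c (ε / 2) (ENNReal.half_pos hε.ne')
    calc e c c ≤ e c y + e y c := he _ _ _
      _ ≤ ε / 2 + ε / 2 := add_le_add hy.le (hsym c y ▸ hy.le)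
      _ = 0 + ε := by rw [ENNReal.add_halves, zero_add]
  have hdrefl : ∀ c, d c c = 0 := by
    intro c
    rw [← nonpos_iff_eq_zero]
    refine le_of_forall_pos_le_add fun ε hε => ?_
    obtain ⟨δ, -, H⟩ := h2 ε hε
    rw [zero_add]
    exact H c c (by simp [hrefl])
  have hne : Y₀.Nonempty := by
    obtain ⟨y, hy, -⟩ := hnear (x hι.some) 1 one_pos
    exact ⟨y, hy⟩
  obtain ⟨y, rfl⟩ := hY₀.exists_eq_range hne
  obtain ⟨η, hη, hfast⟩ := exists_increasing_approx hd he hsym hrefl hcomp h1 h2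
  have hα : ∀ n : ℕ, ∃ α, ∀ γ δ, r α γ → r γ δ → d (x γ) (x δ) < min (η n) (2 ^ n)⁻¹ :=
    fun n => hx _ (lt_min (hη n) (by simp))
  choose α hα using hα
  have hβ : ∀ i m : ℕ, ∃ β, ∀ l, r β l →
      d (y i) (x l) ≤ netLiminf r (fun l => d (y i) (x l)) + (2 ^ m)⁻¹ :=
    fun i m => hx.exists_le_netLiminf_add hd (y i) (by simp)
  choose β hβ using hβ
  have hκ : ∀ n : ℕ, ∃ κ, r (α n) κ ∧ r (β n.unpair.1 n.unpair.2) κ := fun n => hr.2 _ _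
  choose κ hκα hκβ using hκ
  obtain ⟨l, hl, hκl⟩ := hr.exists_chain κ
  have hαl : ∀ n, r (α n) (l n) := fun n => hr.1 _ _ _ (hκα n) (hκl n n le_rfl)
  obtain ⟨v, hv, hxv⟩ := hfast (fun n => x (l n))
    fun n => ((hα n _ _ (hαl n) (hl n)).trans_le (min_le_left _ _)).le
  have hvmono : ∀ m n, m ≤ n → d (v m) (v n) = 0 := by
    intro m n hmn
    induction n, hmn using Nat.le_induction with
    | base => exact hdrefl _
    | succ n _ ih =>
      rw [← nonpos_iff_eq_zero]
      simpa [ih, hv n] using hd (v m) (v n) (v (n + 1))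
  obtain ⟨z, hz, hzsup⟩ := hdd (Set.range v) ⟨Set.range_nonempty v, by
    rintro _ ⟨m, rfl⟩ _ ⟨n, rfl⟩
    exact ⟨_, ⟨max m n, rfl⟩, hvmono _ _ (le_max_left _ _), hvmono _ _ (le_max_right _ _)⟩⟩
  have hdxv := h2.tendsto_zero hxv
  simp_rw [hsym (x _) (v _)] at hxv
  have hdvx := h2.tendsto_zero hxv
  refine ⟨z, fun c => ?_, fun c => ?_⟩
  · rw [hzsup c, iSup_range]
    refine iSup_le fun n => ?_
    have hlim := hdvx.add tendsto_inv_two_pow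
    rw [add_zero] at hlim
    refine le_of_tendsto_zero_add hlim ?_
    filter_upwards [eventually_ge_atTop n] with k hk
    have hk1 : d (v n) c ≤ d (v k) c := by
      simpa [hvmono n k hk] using hd (v n) (v k) c
    refine hk1.trans ((hd _ (x (l k)) _).trans ?_)
    rw [add_assoc]
    refine add_le_add le_rfl (le_add_netLiminf (l k) fun δ hδ => (hd _ (x δ) _).trans ?_)
    exact add_le_add ((hα k _ _ (hαl k) hδ).trans_le (min_le_right _ _)).le le_rfl
  · have hyz : ∀ i, d (y i) z ≤ netLiminf r (fun l => d (y i) (x l)) := by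
      intro i
      refine le_of_tendsto_zero_add tendsto_inv_two_pow (Eventually.of_forall fun m => ?_)
      refine le_of_tendsto_zero_add hdxv ?_
      filter_upwards [eventually_ge_atTop (Nat.pair i m)] with n hn
      have hr' : r (β i m) (l n) := by
        have := hκβ (Nat.pair i m)
        rw [Nat.unpair_pair] at this
        exact hr.1 _ _ _ this (hκl _ _ hn)
      have hvz : d (x (l n)) z ≤ d (x (l n)) (v n) := by
        simpa [hz (v n) ⟨n, rfl⟩] using hd (x (l n)) (v n) z
      calc d (y i) z ≤ d (y i) (x (l n)) + d (x (l n)) z := hd _ _ _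
        _ ≤ _ := add_le_add (hβ i m _ hr') hvz
        _ = _ := by rw [add_comm, add_comm (netLiminf _ _)]
    refine le_of_forall_pos_le_add fun ε hε => ?_
    obtain ⟨δ, hδ, H⟩ := h2 (ε / 2) (ENNReal.half_pos hε.ne')
    obtain ⟨_, ⟨i, rfl⟩, hi⟩ := hnear c δ hδ
    calc d c z ≤ d c (y i) + d (y i) z := hd _ _ _
      _ ≤ ε / 2 + (ε / 2 + netLiminf r (fun l => d c (x l))) := by
        refine add_le_add (H _ _ hi.le) ((hyz i).trans (netLiminf_le_add fun l => ?_))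
        exact (hd _ c _).trans (add_le_add (H _ _ (hsym c (y i) ▸ hi.le)) le_rfl)
      _ = _ := by rw [← add_assoc, ENNReal.add_halves, add_comm]
end

section
/- The following are equivalent: (1) X is d-complete; (2) X × ℝ_− is D-complete, where ℝ_− = (−∞,0] and D is the generalized formal ball distance D((x,r),(y,s)) = (d(x,y) + r − s)_+ (equal to ∞ when d(x,y) = ∞, and to max(d(x,y) + r − s, 0) otherwise); (3) X × ℝ_− is ≤^D-complete, i.e. every ≤^D-directed subset of X × ℝ_− has a ≤^D-supremum. -/
open scoped ENNReal

universe u v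

section NetLiminf

variable {ι : Type v} {r : ι → ι → Prop}

theorem netLiminf_add_le_add (hr : DirectedIndex r) {f g : ι → ℝ≥0∞} {a b : ℝ≥0∞} {α : ι}
    (h : ∀ l, r α l → f l + a ≤ g l + b) : netLiminf r f + a ≤ netLiminf r g + b := by
  have : Nonempty ι := ⟨α⟩
  unfold netLiminf
  rw [ENNReal.iSup_add]
  refine iSup_le fun γ => ?_
  obtain ⟨γ', h1, h2⟩ := hr.2 γ α
  refine le_trans ?_ (add_le_add_left (le_iSup (fun γ => ⨅ l : ι, ⨅ _ : r γ l, g l) γ') b)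
  rw [ENNReal.iInf_add (f := fun l => ⨅ _ : r γ' l, g l)]
  refine le_iInf fun l => ?_
  by_cases hl : r γ' l
  · simp only [hl, iInf_pos]
    have hle : (⨅ l : ι, ⨅ _ : r γ l, f l) ≤ f l := iInf₂_le l (hr.1 _ _ _ h1 hl)
    exact (add_le_add_left hle a).trans (h l (hr.1 _ _ _ h2 hl))
  · simp [hl]

theorem netLiminf_le_of_frequently {f : ι → ℝ≥0∞} {a : ℝ≥0∞}
    (h : ∀ γ, ∃ l, r γ l ∧ f l ≤ a) : netLiminf r f ≤ a := by
  refine iSup_le fun γ => ?_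
  obtain ⟨l, hl, hf⟩ := h γ
  exact (iInf₂_le l hl).trans hf

theorem frequently_lt_of_netLiminf_lt {f : ι → ℝ≥0∞} {a : ℝ≥0∞} (h : netLiminf r f < a) (γ : ι) :
    ∃ l, r γ l ∧ f l < a := by
  have h1 : (⨅ l : ι, ⨅ _ : r γ l, f l) < a :=
    (le_iSup (fun γ => ⨅ l : ι, ⨅ _ : r γ l, f l) γ).trans_lt h
  simpa [iInf_lt_iff] using h1

end NetLiminf

section FormalBall

variable {X : Type u}

/-- The radius of the generalized formal ball `(x, t)` is `-t`. -/
noncomputable def ballRadius (p : X × {t : ℝ // t ≤ 0}) : ℝ≥0∞ := ENNReal.ofReal (-p.2.1)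

theorem ballRadius_ne_top (p : X × {t : ℝ // t ≤ 0}) : ballRadius p ≠ ∞ := ENNReal.ofReal_ne_top

theorem exists_ball (x : X) {t : ℝ≥0∞} (ht : t ≠ ∞) :
    ∃ p : X × {t : ℝ // t ≤ 0}, p.1 = x ∧ ballRadius p = t :=
  ⟨(x, ⟨-t.toReal, by simp⟩), rfl, by simp [ballRadius, ht]⟩

variable {d : X → X → ℝ≥0∞} {D : X × {t : ℝ // t ≤ 0} → X × {t : ℝ // t ≤ 0} → ℝ≥0∞}

theorem formalBall_dist_eq
    (hD : ∀ p q, D p q =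
      if d p.1 q.1 = ∞ then ∞
      else ENNReal.ofReal ((d p.1 q.1).toReal + p.2.1 - q.2.1))
    (p q : X × {t : ℝ // t ≤ 0}) :
    D p q = d p.1 q.1 + ballRadius q - ballRadius p := by
  rw [hD]
  have hp := p.2.2
  have hq := q.2.2
  split_ifs with h
  · rw [h, top_add, ENNReal.top_sub (ballRadius_ne_top p)]
  · obtain ⟨t, ht⟩ : ∃ t, d p.1 q.1 = ENNReal.ofReal t ∧ 0 ≤ t :=
      ⟨_, (ENNReal.ofReal_toReal h).symm, ENNReal.toReal_nonneg⟩
    unfold ballRadius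
    rw [ht.1, ENNReal.toReal_ofReal ht.2, ← ENNReal.ofReal_add ht.2 (by linarith),
      ← ENNReal.ofReal_sub _ (by linarith)]
    congr 1
    ring

theorem le_formalBall_dist_add
    (hD : ∀ p q, D p q = d p.1 q.1 + ballRadius q - ballRadius p)
    (p q : X × {t : ℝ // t ≤ 0}) : d p.1 q.1 + ballRadius q ≤ D p q + ballRadius p := by
  rw [hD]
  exact le_tsub_add

theorem isYonedaComplete_formalBall (h : IsYonedaComplete d)
    (hD : ∀ p q, D p q = d p.1 q.1 + ballRadius q - ballRadius p) : IsYonedaComplete D := by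
  intro ι r x hι hr hx
  have hle : ∀ ε : ℝ≥0∞, 0 < ε → ∃ α, ∀ γ δ, r α γ → r γ δ →
      d (x γ).1 (x δ).1 + ballRadius (x δ) ≤ ε + ballRadius (x γ) := by
    intro ε hε
    obtain ⟨α, hα⟩ := hx ε hε
    refine ⟨α, fun γ δ h1 h2 => ?_⟩
    have := (hα γ δ h1 h2).le
    rwa [hD, tsub_le_iff_right] at this
  set ρ := netLiminf r fun l => ballRadius (x l) with hρ
  have hlow : ∀ ε : ℝ≥0∞, 0 < ε → ∃ α, ∀ γ, r α γ → ρ ≤ ε + ballRadius (x γ) := by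
    intro ε hε
    obtain ⟨α, hα⟩ := hle ε hε
    refine ⟨α, fun γ hγ => netLiminf_le_of_frequently fun β => ?_⟩
    obtain ⟨l, h1, h2⟩ := hr.2 β γ
    exact ⟨l, h1, le_add_self.trans (hα γ l hγ h2)⟩
  have hρtop : ρ ≠ ∞ := by
    obtain ⟨α, hα⟩ := hlow 1 one_pos
    obtain ⟨γ, hγ, -⟩ := hr.2 α α
    exact ne_top_of_le_ne_top
      (ENNReal.add_ne_top.2 ⟨ENNReal.one_ne_top, ballRadius_ne_top _⟩) (hα γ hγ)
  have hup : ∀ ε : ℝ≥0∞, 0 < ε → ∃ α, ∀ γ, r α γ → ballRadius (x γ) ≤ ρ + ε := by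
    intro ε hε
    have hε2 : 0 < ε / 2 := ENNReal.half_pos hε.ne'
    obtain ⟨α, hα⟩ := hle (ε / 2) hε2
    obtain ⟨l, hl, hlt⟩ := frequently_lt_of_netLiminf_lt
      (ENNReal.lt_add_right hρtop hε2.ne') α
    refine ⟨l, fun γ hγ => (le_add_self.trans (hα l γ hl hγ)).trans ?_⟩
    calc ε / 2 + ballRadius (x l) ≤ ε / 2 + (ρ + ε / 2) := by gcongr
      _ = ρ + (ε / 2 + ε / 2) := by ring
      _ = ρ + ε := by rw [ENNReal.add_halves]
  have hc : IsCauchyNet d r fun l => (x l).1 := by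
    intro ε hε
    obtain ⟨η, hη, hηε⟩ := exists_between hε
    have hη3 : 0 < η / 3 := ENNReal.div_pos hη.ne' (by simp)
    obtain ⟨α₁, h1⟩ := hle _ hη3
    obtain ⟨α₂, h2⟩ := hlow _ hη3
    obtain ⟨α₃, h3⟩ := hup _ hη3
    obtain ⟨β, hb1, hb2⟩ := hr.2 α₁ α₂
    obtain ⟨α, ha1, ha2⟩ := hr.2 β α₃
    refine ⟨α, fun γ δ hγ hδ => lt_of_le_of_lt ?_ hηε⟩
    refine (ENNReal.add_le_add_iff_right (ballRadius_ne_top (x δ))).1 ?_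
    calc d (x γ).1 (x δ).1 + ballRadius (x δ)
        ≤ η / 3 + ballRadius (x γ) := h1 γ δ (hr.1 _ _ _ hb1 (hr.1 _ _ _ ha1 hγ)) hδ
      _ ≤ η / 3 + (ρ + η / 3) := by gcongr; exact h3 γ (hr.1 _ _ _ ha2 hγ)
      _ ≤ η / 3 + ((η / 3 + ballRadius (x δ)) + η / 3) := by
          gcongr
          exact h2 δ (hr.1 _ _ _ hb2 (hr.1 _ _ _ ha1 (hr.1 _ _ _ hγ hδ)))
      _ = (η / 3 + η / 3 + η / 3) + ballRadius (x δ) := by ring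
      _ = η + ballRadius (x δ) := by rw [ENNReal.add_thirds]
  obtain ⟨z, hz1, hz2⟩ := h ι r _ hι hr hc
  obtain ⟨p, hp1, hp2⟩ := exists_ball z hρtop
  refine ⟨p, fun c => ?_, fun c => ?_⟩
  · rw [hD, tsub_le_iff_right, hp1, hp2]
    refine ENNReal.le_of_forall_pos_le_add fun ε hε _ => ?_
    obtain ⟨α, hα⟩ := hup ε (by exact_mod_cast hε)
    refine (add_le_add_left (hz1 c.1) _).trans ?_
    rw [add_assoc]
    refine netLiminf_add_le_add hr (α := α) fun l hl => ?_
    calc d (x l).1 c.1 + ballRadius c ≤ D (x l) c + ballRadius (x l) :=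
          le_formalBall_dist_add hD _ _
      _ ≤ D (x l) c + (ρ + ε) := by gcongr; exact hα l hl
  · rw [hD, tsub_le_iff_right, hp1, hp2]
    refine ENNReal.le_of_forall_pos_le_add fun ε hε _ => ?_
    obtain ⟨α, hα⟩ := hlow ε (by exact_mod_cast hε)
    refine (add_le_add_left (hz2 c.1) _).trans ?_
    rw [add_assoc]
    refine netLiminf_add_le_add hr (α := α) fun l hl => ?_
    calc d c.1 (x l).1 + ρ ≤ d c.1 (x l).1 + (ε + ballRadius (x l)) := by
          gcongr; exact hα l hl
      _ = d c.1 (x l).1 + ballRadius (x l) + ε := by ring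
      _ ≤ D c (x l) + ballRadius c + ε := by
          gcongr ?_ + _; exact le_formalBall_dist_add hD _ _
      _ = D c (x l) + (ballRadius c + ε) := by ring

/-- Balls around the points of a net whose radius exceeds `a` plus the distance to all later
points by a positive gap. -/
def netBalls {ι : Type v} (d : X → X → ℝ≥0∞) (r : ι → ι → Prop) (x : ι → X) (a : ℝ≥0∞) :
    Set (X × {t : ℝ // t ≤ 0}) :=
  {p | ∃ l, p.1 = x l ∧ ∃ ε : ℝ≥0∞, 0 < ε ∧ ∀ δ, r l δ → d (x l) (x δ) + ε + a ≤ ballRadius p}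

section NetBalls

variable {ι : Type v} {r : ι → ι → Prop} {x : ι → X} {a : ℝ≥0∞}

theorem exists_mem_netBalls (hx : IsCauchyNet d r x) {ε : ℝ≥0∞} (hε : 0 < ε) :
    ∃ α, ∀ l, r α l → ∀ p : X × {t : ℝ // t ≤ 0},
      p.1 = x l → ballRadius p = ε + a → p ∈ netBalls d r x a := by
  have hε2 := ENNReal.half_pos hε.ne'
  obtain ⟨α, hα⟩ := hx _ hε2
  refine ⟨α, fun l hl p hp1 hp2 => ⟨l, hp1, ε / 2, hε2, fun δ hδ => ?_⟩⟩
  calc d (x l) (x δ) + ε / 2 + a ≤ ε / 2 + ε / 2 + a := by gcongr; exact (hα l δ hl hδ).le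
    _ = ballRadius p := by rw [ENNReal.add_halves, hp2]

theorem leDDirected_netBalls (hD : ∀ p q, D p q = d p.1 q.1 + ballRadius q - ballRadius p)
    [Nonempty ι] (hr : DirectedIndex r) (hx : IsCauchyNet d r x) (ha : a ≠ ∞) :
    LeDDirected D (netBalls d r x a) := by
  constructor
  · obtain ⟨α, hα⟩ := exists_mem_netBalls (a := a) hx one_pos
    obtain ⟨l, hl, -⟩ := hr.2 α α
    obtain ⟨p, hp1, hp2⟩ := exists_ball (x l) (ENNReal.add_ne_top.2 ⟨ENNReal.one_ne_top, ha⟩)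
    exact ⟨p, hα l hl p hp1 hp2⟩
  · rintro p ⟨l, hp, ε₁, h1, hl⟩ q ⟨m, hq, ε₂, h2, hm⟩
    have hε : 0 < min 1 (min ε₁ ε₂) := lt_min one_pos (lt_min h1 h2)
    obtain ⟨α, hα⟩ := exists_mem_netBalls (a := a) hx hε
    obtain ⟨β, hb1, hb2⟩ := hr.2 l m
    obtain ⟨δ, hd1, hd2⟩ := hr.2 β α
    obtain ⟨y, hy1, hy2⟩ := exists_ball (x δ) (ENNReal.add_ne_top.2
      ⟨ne_top_of_le_ne_top ENNReal.one_ne_top (min_le_left 1 (min ε₁ ε₂)), ha⟩)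
    refine ⟨y, hα δ hd2 y hy1 hy2, ?_, ?_⟩
    · rw [hD, tsub_eq_zero_iff_le, hy2, hp, hy1, ← add_assoc]
      refine le_trans ?_ (hl δ (hr.1 _ _ _ hb1 hd1))
      gcongr
      exact (min_le_right _ _).trans (min_le_left _ _)
    · rw [hD, tsub_eq_zero_iff_le, hy2, hq, hy1, ← add_assoc]
      refine le_trans ?_ (hm δ (hr.1 _ _ _ hb2 hd1))
      gcongr
      exact (min_le_right _ _).trans (min_le_right _ _)

theorem netBalls_upperBound (hd : IsDistance d)
    (hD : ∀ p q, D p q = d p.1 q.1 + ballRadius q - ballRadius p)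
    {w : X × {t : ℝ // t ≤ 0}}
    (h : ∀ ε : ℝ≥0∞, 0 < ε → ∀ l, ∃ δ, r l δ ∧ d (x δ) w.1 + ballRadius w ≤ ε + a) :
    ∀ y ∈ netBalls d r x a, D y w = 0 := by
  rintro p ⟨l, hp, ε, hε, hl⟩
  obtain ⟨δ, h1, h2⟩ := h ε hε l
  rw [hD, tsub_eq_zero_iff_le, hp]
  calc d (x l) w.1 + ballRadius w ≤ d (x l) (x δ) + d (x δ) w.1 + ballRadius w := by
        gcongr; exact hd _ _ _
    _ = d (x l) (x δ) + (d (x δ) w.1 + ballRadius w) := add_assoc _ _ _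
    _ ≤ d (x l) (x δ) + (ε + a) := by gcongr
    _ = d (x l) (x δ) + ε + a := (add_assoc _ _ _).symm
    _ ≤ ballRadius p := hl δ h1

theorem eventually_le_of_upperBound (hD : ∀ p q, D p q = d p.1 q.1 + ballRadius q - ballRadius p)
    (hx : IsCauchyNet d r x) (ha : a ≠ ∞) {w : X × {t : ℝ // t ≤ 0}}
    (hw : ∀ y ∈ netBalls d r x a, D y w = 0) {ε : ℝ≥0∞} (hε : 0 < ε) :
    ∃ α, ∀ l, r α l → d (x l) w.1 + ballRadius w ≤ ε + a := by
  have hε' : 0 < min 1 ε := lt_min one_pos hε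
  obtain ⟨α, hα⟩ := exists_mem_netBalls (a := a) hx hε'
  refine ⟨α, fun l hl => ?_⟩
  obtain ⟨p, hp1, hp2⟩ := exists_ball (x l) (ENNReal.add_ne_top.2
    ⟨ne_top_of_le_ne_top ENNReal.one_ne_top (min_le_left 1 ε), ha⟩)
  have := hw p (hα l hl p hp1 hp2)
  rw [hD, tsub_eq_zero_iff_le, hp1, hp2] at this
  refine this.trans ?_
  gcongr
  exact min_le_right _ _

theorem ballRadius_le_of_upperBound (hD : ∀ p q, D p q = d p.1 q.1 + ballRadius q - ballRadius p)
    (hr : DirectedIndex r) (hx : IsCauchyNet d r x) (ha : a ≠ ∞) {w : X × {t : ℝ // t ≤ 0}}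
    (hw : ∀ y ∈ netBalls d r x a, D y w = 0) : ballRadius w ≤ a := by
  refine ENNReal.le_of_forall_pos_le_add fun ε hε _ => ?_
  obtain ⟨α, hα⟩ := eventually_le_of_upperBound hD hx ha hw (ε := ε) (by exact_mod_cast hε)
  obtain ⟨l, hl, -⟩ := hr.2 α α
  rw [add_comm]
  exact le_add_self.trans (hα l hl)

end NetBalls

theorem isYonedaComplete_of_formalBall_sup (hd : IsDistance d)
    (hD : ∀ p q, D p q = d p.1 q.1 + ballRadius q - ballRadius p)
    (h : ∀ Y : Set (X × {t : ℝ // t ≤ 0}), LeDDirected D Y → ∃ z, IsLeDSup D Y z) :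
    IsYonedaComplete d := by
  intro ι r x hι hr hx
  obtain ⟨p, hp, hpmin⟩ := h _ (leDDirected_netBalls hD hr hx ENNReal.zero_ne_top)
  have hp0 : ballRadius p = 0 :=
    nonpos_iff_eq_zero.1 (ballRadius_le_of_upperBound hD hr hx ENNReal.zero_ne_top hp)
  have hlim : ∀ ε : ℝ≥0∞, 0 < ε → ∃ α, ∀ l, r α l → d (x l) p.1 ≤ ε := by
    intro ε hε
    simpa [hp0] using eventually_le_of_upperBound hD hx ENNReal.zero_ne_top hp hε
  refine ⟨p.1, fun c => ?_, fun c => ?_⟩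
  · refine ENNReal.le_of_forall_pos_le_add fun η hη htop => ?_
    set s := netLiminf r (fun l => d (x l) c) + η with hs
    have hs_top : s ≠ ∞ := ENNReal.add_ne_top.2 ⟨htop.ne, ENNReal.coe_ne_top⟩
    have hlt : netLiminf r (fun l => d (x l) c) < s :=
      ENNReal.lt_add_right htop.ne (by exact_mod_cast hη.ne')
    obtain ⟨q, hq, hqmin⟩ := h _ (leDDirected_netBalls hD hr hx hs_top)
    have hqs : ballRadius q = s := by
      refine le_antisymm (ballRadius_le_of_upperBound hD hr hx hs_top hq) ?_
      obtain ⟨w, hw1, hw2⟩ := exists_ball p.1 hs_top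
      have := hqmin w (netBalls_upperBound hd hD fun ε hε l => ?_)
      · rw [hD, tsub_eq_zero_iff_le, hw2] at this
        exact le_add_self.trans this
      · obtain ⟨α, hα⟩ := hlim ε hε
        obtain ⟨δ, h1, h2⟩ := hr.2 l α
        refine ⟨δ, h1, ?_⟩
        rw [hw1, hw2]
        gcongr
        exact hα δ h2
    have hpq : d p.1 q.1 = 0 := by
      obtain ⟨w, hw1, hw2⟩ := exists_ball q.1 ENNReal.zero_ne_top
      have := hpmin w (netBalls_upperBound hd hD fun ε hε l => ?_)
      · rw [hD, tsub_eq_zero_iff_le, hw1, hw2, hp0] at this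
        simpa using this
      · obtain ⟨α, hα⟩ := eventually_le_of_upperBound hD hx hs_top hq hε
        obtain ⟨δ, h1, h2⟩ := hr.2 l α
        refine ⟨δ, h1, ?_⟩
        have := hα δ h2
        rw [hqs] at this
        rw [hw1, hw2, add_zero, add_zero]
        exact (ENNReal.add_le_add_iff_right hs_top).1 this
    have hqc : d q.1 c ≤ s := by
      obtain ⟨w, hw1, hw2⟩ := exists_ball c ENNReal.zero_ne_top
      have := hqmin w (netBalls_upperBound hd hD fun ε hε l => ?_)
      · rwa [hD, tsub_eq_zero_iff_le, hw1, hw2, hqs, add_zero] at this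
      · obtain ⟨δ, h1, h2⟩ := frequently_lt_of_netLiminf_lt hlt l
        refine ⟨δ, h1, ?_⟩
        rw [hw1, hw2, add_zero]
        exact h2.le.trans le_add_self
    calc d p.1 c ≤ d p.1 q.1 + d q.1 c := hd _ _ _
      _ ≤ s := by rw [hpq, zero_add]; exact hqc
  · refine ENNReal.le_of_forall_pos_le_add fun η hη _ => ?_
    obtain ⟨α, hα⟩ := hlim η (by exact_mod_cast hη)
    have key : netLiminf r (fun _ : ι => d c p.1) + 0 ≤ netLiminf r (fun l => d c (x l)) + η :=
      netLiminf_add_le_add hr (α := α) fun l hl => by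
        rw [add_zero]
        exact (hd _ (x l) _).trans (by gcongr; exact hα l hl)
    refine le_trans ?_ key
    rw [add_zero]
    exact le_iSup_of_le α (le_iInf₂ fun _ _ => le_rfl)

end FormalBall

theorem IsYonedaComplete.exists_isLeDSup {Z : Type u} {f : Z → Z → ℝ≥0∞} (hf : IsDistance f)
    (h : IsYonedaComplete f) {Y : Set Z} (hY : LeDDirected f Y) : ∃ z, IsLeDSup f Y z := by
  have htrans : ∀ a b c, f a b = 0 → f b c = 0 → f a c = 0 := fun a b c h1 h2 =>
    nonpos_iff_eq_zero.1 ((hf a b c).trans (by rw [h1, h2, add_zero]))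
  have hdir : DirectedIndex fun a b : Y => f a b = 0 :=
    ⟨fun a b c => htrans a b c, fun a b => by
      obtain ⟨y, hy, h1, h2⟩ := hY.2 a a.2 b b.2
      exact ⟨⟨y, hy⟩, h1, h2⟩⟩
  have : Nonempty Y := hY.1.to_subtype
  obtain ⟨z, hz1, hz2⟩ := h Y _ Subtype.val this hdir fun ε hε =>
    ⟨Classical.arbitrary _, fun γ δ _ hδ => by rwa [hδ]⟩
  refine ⟨z, fun y hy => ?_, fun w hw => ?_⟩
  · refine nonpos_iff_eq_zero.1 ((hz2 y).trans (netLiminf_le_of_frequently fun γ => ?_))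
    obtain ⟨l, h1, h2⟩ := hdir.2 γ ⟨y, hy⟩
    exact ⟨l, h1, h2.le⟩
  · refine nonpos_iff_eq_zero.1 ((hz1 w).trans (netLiminf_le_of_frequently fun γ => ?_))
    obtain ⟨l, h1, -⟩ := hdir.2 γ γ
    exact ⟨l, h1, (hw l l.2).le⟩

theorem isDistance_formalBall {X : Type u} {d : X → X → ℝ≥0∞}
    {D : X × {t : ℝ // t ≤ 0} → X × {t : ℝ // t ≤ 0} → ℝ≥0∞} (hd : IsDistance d)
    (hD : ∀ p q, D p q = d p.1 q.1 + ballRadius q - ballRadius p) : IsDistance D := by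
  intro p q w
  rw [hD p w, tsub_le_iff_right]
  calc d p.1 w.1 + ballRadius w ≤ d p.1 q.1 + d q.1 w.1 + ballRadius w := by
        gcongr; exact hd _ _ _
    _ = d p.1 q.1 + (d q.1 w.1 + ballRadius w) := add_assoc _ _ _
    _ ≤ d p.1 q.1 + (D q w + ballRadius q) := by
        gcongr _ + ?_
        exact le_formalBall_dist_add hD _ _
    _ = d p.1 q.1 + ballRadius q + D q w := by ring
    _ ≤ D p q + ballRadius p + D q w := by
        gcongr ?_ + _
        exact le_formalBall_dist_add hD _ _
    _ = D p q + D q w + ballRadius p := by ring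

/-- The Kostanek–Waszkiewicz theorem for generalized formal balls:
`X` is d-complete iff `X × ℝ₋` is D-complete iff `X × ℝ₋` is `≤ᴰ`-complete. -/
theorem kostanek_waszkiewicz {X : Type u}
    (d : X → X → ℝ≥0∞) (hd : IsDistance d)
    (D : X × {t : ℝ // t ≤ 0} → X × {t : ℝ // t ≤ 0} → ℝ≥0∞)
    (hD : ∀ p q, D p q =
      if d p.1 q.1 = ∞ then ∞
      else ENNReal.ofReal ((d p.1 q.1).toReal + p.2.1 - q.2.1)) :
    (IsYonedaComplete d ↔ IsYonedaComplete D) ∧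
    (IsYonedaComplete D ↔
      ∀ Y : Set (X × {t : ℝ // t ≤ 0}), LeDDirected D Y → ∃ z, IsLeDSup D Y z) := by
  have hD' := formalBall_dist_eq hD
  have h23 : IsYonedaComplete D →
      ∀ Y : Set (X × {t : ℝ // t ≤ 0}), LeDDirected D Y → ∃ z, IsLeDSup D Y z :=
    fun h _ hY => h.exists_isLeDSup (isDistance_formalBall hd hD') hY
  exact ⟨⟨fun h => isYonedaComplete_formalBall h hD',
      fun h => isYonedaComplete_of_formalBall_sup hd hD' (h23 h)⟩,
    h23, fun h => isYonedaComplete_formalBall (isYonedaComplete_of_formalBall_sup hd hD' h) hD'⟩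
end
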